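/- Let K be a field and let |·|₁, |·|₂, …, |·|ₙ be nontrivial absolute values on K that are pairwise inequivalent (no two induce the same topology). Then there exists x ∈ K such that |x|₁ > 1 and |x|ᵢ < 1 for every i with 2 ≤ i ≤ n. -/

import Mathlib

/-- The topology on a field `K` induced by an absolute value `f : K → ℝ`,
namely the topology of the metric `d(x,y) = f (x - y)`, generated by the open balls. -/
def absTopology {K : Type*} [Field K] (f : AbsoluteValue K ℝ) : TopologicalSpace K :=
  TopologicalSpace.generateFrom
    {s : Set K | ∃ (a : K) (r : ℝ), 0 < r ∧ s = {x : K | f (x - a) < r}}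

/-- If `w` is a positive power of `v`, every open ball of `v` is an open ball of `w`. -/
theorem AbsoluteValue.setOf_ball_subset_of_rpow_eq {K : Type*} [Field K]
    {v w : AbsoluteValue K ℝ} {c : ℝ} (hc : 0 < c) (h : ∀ x, v x ^ c = w x) :
    {s : Set K | ∃ (a : K) (r : ℝ), 0 < r ∧ s = {x : K | v (x - a) < r}} ⊆
      {s : Set K | ∃ (a : K) (r : ℝ), 0 < r ∧ s = {x : K | w (x - a) < r}} := by
  rintro _ ⟨a, r, hr, rfl⟩
  refine ⟨a, r ^ c, Real.rpow_pos_of_pos hr c, ?_⟩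
  ext x
  simp only [Set.mem_ofPred_eq, ← h]
  exact (Real.rpow_lt_rpow_iff (v.nonneg _) hr.le hc).symm

theorem AbsoluteValue.IsEquiv.absTopology_eq {K : Type*} [Field K]
    {v w : AbsoluteValue K ℝ} (h : v.IsEquiv w) : absTopology v = absTopology w := by
  obtain ⟨c, hc, hvw⟩ := AbsoluteValue.isEquiv_iff_exists_rpow_eq.1 h
  obtain ⟨d, hd, hwv⟩ := AbsoluteValue.isEquiv_iff_exists_rpow_eq.1 h.symm
  exact congrArg TopologicalSpace.generateFrom <| Set.Subset.antisymm
    (AbsoluteValue.setOf_ball_subset_of_rpow_eq hc (congrFun hvw))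
    (AbsoluteValue.setOf_ball_subset_of_rpow_eq hd (congrFun hwv))

/-- Given finitely many nontrivial, pairwise inequivalent absolute values on a field `K`,
there is an element `x ∈ K` with `|x|₁ > 1` and `|x|ᵢ < 1` for all `i ≥ 2`. -/
theorem exists_gt_one_and_lt_one {K : Type*} [Field K] (n : ℕ) (hn : 0 < n)
    (f : Fin n → AbsoluteValue K ℝ)
    (hnontriv : ∀ i, ∃ x : K, x ≠ 0 ∧ f i x ≠ 1)
    (hineq : ∀ i j, i ≠ j → absTopology (f i) ≠ absTopology (f j)) :
    ∃ x : K, 1 < f ⟨0, hn⟩ x ∧ ∀ i : Fin n, i ≠ ⟨0, hn⟩ → f i x < 1 := by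
  obtain ⟨x, hx, hlt⟩ := AbsoluteValue.exists_one_lt_lt_one_pi_of_not_isEquiv hnontriv
    (fun i j hij h ↦ hineq i j hij h.absTopology_eq) ⟨0, hn⟩
  exact ⟨x, hx, hlt⟩
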